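/- Let P be a probability measure on Ω = Σ^ℕ. Then for every n ≥ 1: H̄(P) = H̄(P_n) and H̲(P) = H̲(P_n), where P_n := (1/n)·Σ_{i=0}^{n−1} P∘T^{−i}. -/

import Mathlib

open MeasureTheory Filter
open scoped ENNReal

variable {α : Type*}

/-- The cylinder set of sequences in `Ω = Σ^ℕ` whose first `t` symbols are `v`. -/
def cylinder (t : ℕ) (v : Fin t → α) : Set (ℕ → α) :=
  {ω | ∀ i : Fin t, ω (i : ℕ) = v i}

variable [Fintype α] [Nonempty α] [MeasurableSpace α] [DiscreteMeasurableSpace α]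

/-- `P(v)`, the probability that the source emits the word `v`. -/
noncomputable def wordProb (P : Measure (ℕ → α)) {t : ℕ} (v : Fin t → α) : ℝ :=
  (P (cylinder t v)).toReal

/-- `H^t(P)`, the entropy of the induced distribution on words of length `t`, divided
by `t` (natural logarithm; the convention `0 · log 0 = 0` holds since `Real.log 0 = 0`). -/
noncomputable def Hn (P : Measure (ℕ → α)) (t : ℕ) : ℝ :=
  -(1 / (t : ℝ)) * ∑ v : Fin t → α, wordProb P v * Real.log (wordProb P v)

/-- `d_{TV,t}(P,Q) = Σ_{v ∈ Σ^t} |P(v) − Q(v)|`. -/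
noncomputable def dTVt (P Q : Measure (ℕ → α)) (t : ℕ) : ℝ :=
  ∑ v : Fin t → α, |wordProb P v - wordProb Q v|

/-- `d_TV(P,Q) = sup_{t ∈ ℕ} d_{TV,t}(P,Q)`. -/
noncomputable def dTV (P Q : Measure (ℕ → α)) : ℝ := ⨆ t : ℕ, dTVt P Q t

/-- The shift operator `T` on `Ω = Σ^ℕ`: `T(v₀v₁v₂…) = v₁v₂…`. -/
def shift : (ℕ → α) → (ℕ → α) := fun ω n => ω (n + 1)

/-- `P_n := (1/n) Σ_{i=0}^{n−1} P ∘ T^{−i}` (as a measure on `Ω`). -/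
noncomputable def cesaroAvg (P : Measure (ℕ → α)) (n : ℕ) : Measure (ℕ → α) :=
  (n : ℝ≥0∞)⁻¹ • ∑ i ∈ Finset.range n, P.map (shift^[i])

/-- `P_n := (1/n) Σ_{i=0}^{n−1} P ∘ T^{−i}`, as a finite signed measure on `Ω`. -/
noncomputable def cesaroAvgS (P : Measure (ℕ → α)) [IsFiniteMeasure P] (n : ℕ) :
    SignedMeasure (ℕ → α) :=
  (n : ℝ)⁻¹ • ∑ i ∈ Finset.range n, (P.toSignedMeasure).map (shift^[i])

section Entropy

open Real

variable {ι κ : Type*} [Fintype ι] [Fintype κ]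

/-- Splitting a mass `∑ i, x i` into the pieces `x i` does not decrease `negMulLog`. -/
lemma negMulLog_sum_le_sum_negMulLog (x : ι → ℝ) (hx : ∀ i, 0 ≤ x i) :
    negMulLog (∑ i, x i) ≤ ∑ i, negMulLog (x i) := by
  have hsum : negMulLog (∑ i, x i) = ∑ i, -(x i * log (∑ j, x j)) := by
    rw [Finset.sum_neg_distrib, ← Finset.sum_mul, negMulLog, neg_mul]
  rw [hsum]
  refine Finset.sum_le_sum fun i _ => ?_
  rw [negMulLog, neg_mul, neg_le_neg_iff]
  rcases (hx i).eq_or_lt with h | h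
  · simp [← h]
  · exact mul_le_mul_of_nonneg_left
      (log_le_log h (Finset.single_le_sum (fun j _ => hx j) (Finset.mem_univ i))) h.le

/-- Splitting a mass into `card ι` pieces increases `negMulLog` at most by the mass times
`log (card ι)`. -/
lemma sum_negMulLog_le_negMulLog_sum_add (x : ι → ℝ) (hx : ∀ i, 0 ≤ x i) :
    ∑ i, negMulLog (x i) ≤ negMulLog (∑ i, x i) + (∑ i, x i) * log (Fintype.card ι) := by
  rcases isEmpty_or_nonempty ι with h | h
  · simp
  have hc : (0 : ℝ) < Fintype.card ι := by exact_mod_cast Fintype.card_pos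
  have key := concaveOn_negMulLog.le_map_sum (t := Finset.univ)
    (w := fun _ : ι => (Fintype.card ι : ℝ)⁻¹) (p := x)
    (fun _ _ => by positivity) (by simp [hc.ne']) (fun i _ => hx i)
  simp only [smul_eq_mul, ← Finset.mul_sum, negMulLog_mul] at key
  have hlog : negMulLog (Fintype.card ι : ℝ)⁻¹
      = (Fintype.card ι : ℝ)⁻¹ * log (Fintype.card ι) := by simp [negMulLog]
  rw [hlog] at key
  refine le_of_mul_le_mul_left (key.trans_eq ?_) (inv_pos.2 hc)
  ring

/-- Passing from a distribution on `κ × ι` to its marginal on `κ` changes the entropy by at most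
`log (card ι)`. -/
lemma entropy_marginal_bounds (q : κ → ι → ℝ) (p : κ → ℝ) (hq : ∀ k i, 0 ≤ q k i)
    (hqp : ∀ k, ∑ i, q k i = p k) (hp : ∑ k, p k = 1) :
    ∑ k, negMulLog (p k) ≤ ∑ k, ∑ i, negMulLog (q k i) ∧
      ∑ k, ∑ i, negMulLog (q k i) ≤ ∑ k, negMulLog (p k) + log (Fintype.card ι) := by
  refine ⟨Finset.sum_le_sum fun k _ => ?_, ?_⟩
  · rw [← hqp k]
    exact negMulLog_sum_le_sum_negMulLog _ (hq k)
  · calc ∑ k, ∑ i, negMulLog (q k i)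
        ≤ ∑ k, (negMulLog (p k) + p k * log (Fintype.card ι)) :=
          Finset.sum_le_sum fun k _ => by
            rw [← hqp k]
            exact sum_negMulLog_le_negMulLog_sum_add _ (hq k)
      _ = ∑ k, negMulLog (p k) + log (Fintype.card ι) := by
          rw [Finset.sum_add_distrib, ← Finset.sum_mul, hp, one_mul]

/-- The entropy of a uniform mixture of `card ι` distributions differs from the average of their
entropies by at most `log (card ι)`. -/
lemma abs_entropy_mixture_sub_le [Nonempty ι] (p : ι → κ → ℝ) (hp : ∀ i k, 0 ≤ p i k)
    (hp1 : ∀ i, ∑ k, p i k = 1) :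
    |∑ k, negMulLog ((Fintype.card ι : ℝ)⁻¹ * ∑ i, p i k)
      - (Fintype.card ι : ℝ)⁻¹ * ∑ i, ∑ k, negMulLog (p i k)| ≤ log (Fintype.card ι) := by
  set c : ℝ := (Fintype.card ι : ℝ) with hc_def
  have hc : 0 < c := by rw [hc_def]; exact Nat.cast_pos.2 Fintype.card_pos
  have hone : ∑ k, c⁻¹ * ∑ i, p i k = 1 := by
    rw [← Finset.mul_sum, Finset.sum_comm]
    simp [hp1, ← hc_def, hc.ne']
  obtain ⟨h₁, h₂⟩ := entropy_marginal_bounds (fun k i => c⁻¹ * p i k)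
    (fun k => c⁻¹ * ∑ i, p i k) (fun k i => mul_nonneg (by positivity) (hp i k))
    (fun k => (Finset.mul_sum _ _ _).symm) hone
  have hsplit : ∑ k, ∑ i, negMulLog (c⁻¹ * p i k)
      = log c + c⁻¹ * ∑ i, ∑ k, negMulLog (p i k) := by
    have hlog : negMulLog c⁻¹ = c⁻¹ * log c := by simp [negMulLog]
    rw [Finset.sum_comm]
    simp only [negMulLog_mul, hlog, Finset.sum_add_distrib, ← Finset.sum_mul, ← Finset.mul_sum,
      hp1]
    simp [← hc_def, hc.ne']
  rw [hsplit] at h₁ h₂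
  rw [abs_le]
  constructor <;> linarith [log_natCast_nonneg (Fintype.card ι)]

end Entropy

lemma limsup_le_and_liminf_le_of_tendsto_sub {u v : ℕ → ℝ}
    (hu : IsBoundedUnder (· ≤ ·) atTop u) (hu' : IsBoundedUnder (· ≥ ·) atTop u)
    (h : Tendsto (fun t => v t - u t) atTop (nhds 0)) :
    limsup v atTop ≤ limsup u atTop ∧ liminf u atTop ≤ liminf v atTop := by
  have hv : v = u + fun t => v t - u t := by ext t; simp
  constructor
  · calc limsup v atTop = limsup (u + fun t => v t - u t) atTop := by rw [← hv]
      _ ≤ limsup u atTop + limsup (fun t => v t - u t) atTop :=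
          limsup_add_le hu' hu h.isCoboundedUnder_le h.isBoundedUnder_le
      _ = limsup u atTop := by rw [h.limsup_eq, add_zero]
  · calc liminf u atTop = liminf u atTop + liminf (fun t => v t - u t) atTop := by
          rw [h.liminf_eq, add_zero]
      _ ≤ liminf (u + fun t => v t - u t) atTop :=
          le_liminf_add hu' hu h.isBoundedUnder_ge h.isCoboundedUnder_ge
      _ = liminf v atTop := by rw [← hv]

set_option linter.unusedSectionVars false

/-- The (unnormalized) entropy of the distribution on words of length `t`. -/
noncomputable def wordEntropy (P : Measure (ℕ → α)) (t : ℕ) : ℝ :=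
  ∑ v : Fin t → α, Real.negMulLog (wordProb P v)

lemma sum_negMulLog_wordProb (P : Measure (ℕ → α)) (t : ℕ) :
    ∑ v : Fin t → α, Real.negMulLog (wordProb P v) = wordEntropy P t := rfl

lemma Hn_eq_wordEntropy_div (P : Measure (ℕ → α)) (t : ℕ) : Hn P t = wordEntropy P t / t := by
  simp only [Hn, wordEntropy, Real.negMulLog, neg_mul, Finset.sum_neg_distrib]
  ring

lemma wordProb_nonneg (P : Measure (ℕ → α)) {t : ℕ} (v : Fin t → α) : 0 ≤ wordProb P v :=
  ENNReal.toReal_nonneg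

lemma measurableSet_cylinder (t : ℕ) (v : Fin t → α) : MeasurableSet (cylinder t v) := by
  have : cylinder t v = ⋂ i : Fin t, (fun ω : ℕ → α => ω i) ⁻¹' {v i} := by
    ext ω; simp [_root_.cylinder]
  rw [this]
  exact MeasurableSet.iInter fun i => measurable_pi_apply _ (measurableSet_singleton _)

lemma measurable_shift : Measurable (shift : (ℕ → α) → ℕ → α) :=
  measurable_pi_lambda _ fun _ => measurable_pi_apply _

lemma sum_measureReal_inter_coordinate (P : Measure (ℕ → α)) [IsFiniteMeasure P] (k : ℕ)
    {s : Set (ℕ → α)} (hs : MeasurableSet s) :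
    ∑ a, P.real (s ∩ {ω | ω k = a}) = P.real s := by
  have hm : ∀ a, MeasurableSet {ω : ℕ → α | ω k = a} := fun a =>
    (measurable_pi_apply (X := fun _ : ℕ => α) k) (measurableSet_singleton a)
  rw [← measureReal_biUnion_finset]
  · congr 1
    ext ω
    simp
  · intro a _ b _ hab
    refine Set.disjoint_left.2 fun ω ha hb => hab ?_
    exact ha.2.symm.trans hb.2
  · exact fun a _ => hs.inter (hm a)

lemma sum_wordProb_snoc (P : Measure (ℕ → α)) [IsFiniteMeasure P] {t : ℕ} (v : Fin t → α) :
    ∑ a, wordProb P (Fin.snoc v a : Fin (t + 1) → α) = wordProb P v := by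
  rw [show wordProb P v = P.real (cylinder t v) from rfl,
    ← sum_measureReal_inter_coordinate P t (measurableSet_cylinder t v)]
  refine Finset.sum_congr rfl fun a _ => ?_
  rw [wordProb, Measure.real]
  congr 2
  ext ω
  simp [_root_.cylinder, Fin.forall_fin_succ']

lemma sum_wordProb_cons (P : Measure (ℕ → α)) [IsFiniteMeasure P] {t : ℕ} (v : Fin t → α) :
    ∑ a, wordProb P (Fin.cons a v : Fin (t + 1) → α) = wordProb (P.map shift) v := by
  rw [show wordProb (P.map shift) v = (P.map shift).real (cylinder t v) from rfl,
    map_measureReal_apply measurable_shift (measurableSet_cylinder t v),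
    ← sum_measureReal_inter_coordinate P 0 (measurable_shift (measurableSet_cylinder t v))]
  refine Finset.sum_congr rfl fun a _ => ?_
  rw [wordProb, Measure.real]
  congr 2
  ext ω
  simp [_root_.cylinder, shift, Fin.forall_fin_succ, and_comm]

lemma sum_wordProb (P : Measure (ℕ → α)) [IsProbabilityMeasure P] (t : ℕ) :
    ∑ v : Fin t → α, wordProb P v = 1 := by
  induction t with
  | zero => simp [wordProb, _root_.cylinder]
  | succ t ih =>
    rw [← (Fin.snocEquiv fun _ => α).sum_comp, Fintype.sum_prod_type_right, ← ih]
    exact Finset.sum_congr rfl fun v _ => sum_wordProb_snoc P v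

lemma abs_wordEntropy_map_shift_sub_le (P : Measure (ℕ → α)) [IsProbabilityMeasure P] (t : ℕ) :
    |wordEntropy (P.map shift) t - wordEntropy P t| ≤ Real.log (Fintype.card α) := by
  have : IsProbabilityMeasure (P.map shift) :=
    Measure.isProbabilityMeasure_map measurable_shift.aemeasurable
  obtain ⟨h₁, h₂⟩ := entropy_marginal_bounds
    (fun (v : Fin t → α) a => wordProb P (Fin.snoc v a : Fin (t + 1) → α)) (fun v => wordProb P v)
    (fun _ _ => wordProb_nonneg P _) (sum_wordProb_snoc P) (sum_wordProb P t)
  obtain ⟨h₃, h₄⟩ := entropy_marginal_bounds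
    (fun (v : Fin t → α) a => wordProb P (Fin.cons a v : Fin (t + 1) → α))
    (fun v => wordProb (P.map shift) v)
    (fun _ _ => wordProb_nonneg P _) (sum_wordProb_cons P) (sum_wordProb _ t)
  have hsnoc : wordEntropy P (t + 1) = ∑ v : Fin t → α, ∑ a,
      Real.negMulLog (wordProb P (Fin.snoc v a : Fin (t + 1) → α)) := by
    rw [wordEntropy, ← (Fin.snocEquiv fun _ => α).sum_comp, Fintype.sum_prod_type_right]
    rfl
  have hcons : wordEntropy P (t + 1) = ∑ v : Fin t → α, ∑ a,
      Real.negMulLog (wordProb P (Fin.cons a v : Fin (t + 1) → α)) := by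
    rw [wordEntropy, ← (Fin.consEquiv fun _ => α).sum_comp, Fintype.sum_prod_type_right]
    rfl
  rw [← hsnoc] at h₁ h₂
  rw [← hcons] at h₃ h₄
  simp only [sum_negMulLog_wordProb] at h₁ h₂ h₃ h₄
  rw [abs_le]
  constructor <;> linarith

lemma abs_wordEntropy_map_iterate_shift_sub_le (P : Measure (ℕ → α)) [IsProbabilityMeasure P]
    (i t : ℕ) :
    |wordEntropy (P.map shift^[i]) t - wordEntropy P t| ≤ i * Real.log (Fintype.card α) := by
  induction i with
  | zero => simp
  | succ i ih =>
    have : IsProbabilityMeasure (P.map shift^[i]) :=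
      Measure.isProbabilityMeasure_map (measurable_shift.iterate i).aemeasurable
    have h := abs_wordEntropy_map_shift_sub_le (P.map shift^[i]) t
    rw [Measure.map_map measurable_shift (measurable_shift.iterate i),
      ← Function.iterate_succ'] at h
    push_cast
    linarith [abs_sub_le (wordEntropy (P.map shift^[i + 1]) t)
      (wordEntropy (P.map shift^[i]) t) (wordEntropy P t)]

lemma wordProb_cesaroAvg (P : Measure (ℕ → α)) [IsFiniteMeasure P] (n : ℕ) {t : ℕ}
    (v : Fin t → α) :
    wordProb (cesaroAvg P n) v = (n : ℝ)⁻¹ * ∑ i : Fin n, wordProb (P.map shift^[i]) v := by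
  rw [Fin.sum_univ_eq_sum_range (fun i => wordProb (P.map shift^[i]) v)]
  simp [wordProb, cesaroAvg, Measure.finsetSum_apply, ENNReal.toReal_sum]

lemma abs_wordEntropy_cesaroAvg_sub_le (P : Measure (ℕ → α)) [IsProbabilityMeasure P]
    {n : ℕ} (hn : 1 ≤ n) (t : ℕ) :
    |wordEntropy (cesaroAvg P n) t - wordEntropy P t|
      ≤ Real.log n + n * Real.log (Fintype.card α) := by
  have : NeZero n := ⟨by lia⟩
  have hn0 : (0 : ℝ) < n := by exact_mod_cast hn
  have hprob : ∀ i, IsProbabilityMeasure (P.map shift^[i]) := fun i =>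
    Measure.isProbabilityMeasure_map (measurable_shift.iterate i).aemeasurable
  have hmix := abs_entropy_mixture_sub_le
    (fun (i : Fin n) (v : Fin t → α) => wordProb (P.map shift^[i]) v)
    (fun _ _ => wordProb_nonneg _ _) (fun i => sum_wordProb _ t)
  simp only [Fintype.card_fin, ← wordProb_cesaroAvg, sum_negMulLog_wordProb] at hmix
  have havg : |(n : ℝ)⁻¹ * ∑ i : Fin n, wordEntropy (P.map shift^[i]) t - wordEntropy P t|
      ≤ n * Real.log (Fintype.card α) := by
    have heq : (n : ℝ)⁻¹ * ∑ i : Fin n, wordEntropy (P.map shift^[i]) t - wordEntropy P t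
        = (n : ℝ)⁻¹ * ∑ i : Fin n, (wordEntropy (P.map shift^[i]) t - wordEntropy P t) := by
      simp [Finset.sum_sub_distrib, mul_sub, hn0.ne']
    rw [heq, abs_mul, abs_of_pos (inv_pos.2 hn0), inv_mul_le_iff₀ hn0]
    calc |∑ i : Fin n, (wordEntropy (P.map shift^[i]) t - wordEntropy P t)|
        ≤ ∑ i : Fin n, |wordEntropy (P.map shift^[i]) t - wordEntropy P t| :=
          Finset.abs_sum_le_sum_abs _ _
      _ ≤ ∑ _i : Fin n, n * Real.log (Fintype.card α) := Finset.sum_le_sum fun i _ =>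
          (abs_wordEntropy_map_iterate_shift_sub_le P i t).trans
            (mul_le_mul_of_nonneg_right (by exact_mod_cast i.2.le)
              (Real.log_natCast_nonneg _))
      _ = n * (n * Real.log (Fintype.card α)) := by simp
  exact (abs_sub_le _ _ _).trans (add_le_add hmix havg)

lemma Hn_nonneg (P : Measure (ℕ → α)) [IsProbabilityMeasure P] (t : ℕ) : 0 ≤ Hn P t := by
  rw [Hn_eq_wordEntropy_div]
  exact div_nonneg (Finset.sum_nonneg fun v _ =>
    Real.negMulLog_nonneg (wordProb_nonneg P v) measureReal_le_one) (Nat.cast_nonneg t)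

lemma Hn_le_log_card (P : Measure (ℕ → α)) [IsProbabilityMeasure P] (t : ℕ) :
    Hn P t ≤ Real.log (Fintype.card α) := by
  rw [Hn_eq_wordEntropy_div]
  refine div_le_of_le_mul₀ (Nat.cast_nonneg t) (Real.log_natCast_nonneg _) ?_
  have h := sum_negMulLog_le_negMulLog_sum_add (fun v : Fin t → α => wordProb P v)
    (wordProb_nonneg P)
  rw [sum_wordProb P t] at h
  simpa [wordEntropy, mul_comm] using h

lemma isProbabilityMeasure_cesaroAvg (P : Measure (ℕ → α)) [IsProbabilityMeasure P]
    {n : ℕ} (hn : 1 ≤ n) : IsProbabilityMeasure (cesaroAvg P n) := by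
  have hprob : ∀ i, IsProbabilityMeasure (P.map shift^[i]) := fun i =>
    Measure.isProbabilityMeasure_map (measurable_shift.iterate i).aemeasurable
  constructor
  have hn0 : (n : ℝ≥0∞) ≠ 0 := by exact_mod_cast (by lia : n ≠ 0)
  simp only [cesaroAvg, Measure.smul_apply, Measure.finsetSum_apply, measure_univ, smul_eq_mul]
  simp [ENNReal.inv_mul_cancel hn0 (ENNReal.natCast_ne_top n)]

lemma tendsto_Hn_cesaroAvg_sub (P : Measure (ℕ → α)) [IsProbabilityMeasure P]
    {n : ℕ} (hn : 1 ≤ n) :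
    Tendsto (fun t => Hn (cesaroAvg P n) t - Hn P t) atTop (nhds 0) := by
  refine squeeze_zero_norm (fun t => ?_) (tendsto_const_div_atTop_nhds_zero_nat
    (Real.log n + n * Real.log (Fintype.card α)))
  rw [Hn_eq_wordEntropy_div, Hn_eq_wordEntropy_div, ← sub_div, Real.norm_eq_abs, abs_div,
    Nat.abs_cast]
  exact div_le_div_of_nonneg_right (abs_wordEntropy_cesaroAvg_sub_le P hn t) (Nat.cast_nonneg t)

/-- Corollary 1: for every `n ≥ 1`, `H̄(P) = H̄(P_n)` and `H̲(P) = H̲(P_n)`. -/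
theorem entropyRates_cesaroAvg_invariant (P : Measure (ℕ → α)) [IsProbabilityMeasure P]
    (n : ℕ) (hn : 1 ≤ n) :
    limsup (Hn P) atTop = limsup (Hn (cesaroAvg P n)) atTop ∧
    liminf (Hn P) atTop = liminf (Hn (cesaroAvg P n)) atTop := by
  have := isProbabilityMeasure_cesaroAvg P hn
  have hle : ∀ Q : Measure (ℕ → α), IsProbabilityMeasure Q →
      IsBoundedUnder (· ≤ ·) atTop (Hn Q) := fun Q _ =>
    isBoundedUnder_of ⟨_, Hn_le_log_card Q⟩
  have hge : ∀ Q : Measure (ℕ → α), IsProbabilityMeasure Q →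
      IsBoundedUnder (· ≥ ·) atTop (Hn Q) := fun Q _ =>
    isBoundedUnder_of ⟨0, Hn_nonneg Q⟩
  have h := tendsto_Hn_cesaroAvg_sub P hn
  have h' : Tendsto (fun t => Hn P t - Hn (cesaroAvg P n) t) atTop (nhds 0) := by
    simpa using h.neg
  obtain ⟨h₁, h₂⟩ := limsup_le_and_liminf_le_of_tendsto_sub (hle P ‹_›) (hge P ‹_›) h
  obtain ⟨h₃, h₄⟩ := limsup_le_and_liminf_le_of_tendsto_sub (hle _ this) (hge _ this) h'
  exact ⟨le_antisymm h₃ h₁, le_antisymm h₂ h₄⟩
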